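/- arXiv:2503.02417 — 2 statements merged into one kernel-verified Lean document; each statement's English description precedes it below -/
import Mathlib

section
/- Let τ ∈ ℂ and let A_τ = {z ∈ ℂ : z² = τ}. Define the constants a_τ = −(1 + τ·e^{7πi/4})/4, b_τ = (3 − τ·e^{7πi/4})/4, c_τ = (1 − τ·e^{7πi/4})/4, d_τ = (5 − τ·e^{7πi/4})/4, and the functions X_{τ,1}(z) = (exp((1/2)·e^{3πi/4}·z²)/(τ−z²)²)·[ τ·M(a_τ, 1/2, e^{7πi/4}·z²) − 4·a_τ·z²·M(b_τ, 3/2, e^{7πi/4}·z²) ] and X_{τ,2}(z) = z·(exp((1/2)·e^{3πi/4}·z²)/(τ−z²)²)·[ M(c_τ, 3/2, e^{7πi/4}·z²) + e^{7πi/4}·(z²/3)·M(d_τ, 5/2, e^{7πi/4}·z²) ], defined for z ∈ ℂ∖A_τ. Then every function X : ℂ∖A_τ → ℂ which is complex differentiable to second order on ℂ∖A_τ and satisfies i·(τ−z²)·X''(z) − 6i·z·X'(z) + ((τ−z²)² − 6i)·X(z) = 0 for every z ∈ ℂ∖A_τ can be written as X(z) = c₁·X_{τ,1}(z) + c₂·X_{τ,2}(z)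 for all z ∈ ℂ∖A_τ, for some constants c₁, c₂ ∈ ℂ. -/
open Complex

/-- Rising Pochhammer symbol in `ℂ`. -/
noncomputable def pochC (x : ℂ) (n : ℕ) : ℂ := ∏ i ∈ Finset.range n, (x + (i : ℂ))

/-- Kummer's confluent hypergeometric function of the first kind. -/
noncomputable def kummerM (a c ζ : ℂ) : ℂ :=
  ∑' n : ℕ, pochC a n / pochC c n * ζ ^ n / (n.factorial : ℂ)

/-- `e^{iθ}`. -/
noncomputable def eIθ (θ : ℝ) : ℂ := Complex.exp (Complex.I * (θ : ℂ))

noncomputable def Xτ1 (τ z : ℂ) : ℂ :=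
  Complex.exp ((1 / 2) * eIθ (3 * Real.pi / 4) * z ^ 2) / (τ - z ^ 2) ^ 2 *
    (τ * kummerM (-(1 + τ * eIθ (7 * Real.pi / 4)) / 4) (1 / 2) (eIθ (7 * Real.pi / 4) * z ^ 2)
      - 4 * (-(1 + τ * eIθ (7 * Real.pi / 4)) / 4) * z ^ 2 *
        kummerM ((3 - τ * eIθ (7 * Real.pi / 4)) / 4) (3 / 2) (eIθ (7 * Real.pi / 4) * z ^ 2))

noncomputable def Xτ2 (τ z : ℂ) : ℂ :=
  z * (Complex.exp ((1 / 2) * eIθ (3 * Real.pi / 4) * z ^ 2) / (τ - z ^ 2) ^ 2) *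
    (kummerM ((1 - τ * eIθ (7 * Real.pi / 4)) / 4) (3 / 2) (eIθ (7 * Real.pi / 4) * z ^ 2)
      + eIθ (7 * Real.pi / 4) * (z ^ 2 / 3) *
        kummerM ((5 - τ * eIθ (7 * Real.pi / 4)) / 4) (5 / 2) (eIθ (7 * Real.pi / 4) * z ^ 2))

open Filter Topology Bornology

theorem pochC_succ (x : ℂ) (n : ℕ) : pochC x (n + 1) = pochC x n * (x + n) := by
  simp [pochC, Finset.prod_range_succ]

theorem pochC_succ_left (x : ℂ) (n : ℕ) : pochC x (n + 1) = x * pochC (x + 1) n := by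
  rw [pochC, Finset.prod_range_succ', mul_comm, pochC]
  congr 1
  · simp
  · refine Finset.prod_congr rfl fun i _ => ?_
    push_cast
    ring

theorem pochC_ne_zero {c : ℂ} (hc : ∀ n : ℕ, c + n ≠ 0) (n : ℕ) : pochC c n ≠ 0 :=
  Finset.prod_ne_zero_iff.mpr fun i _ => hc i

theorem add_one_add_natCast_ne_zero {c : ℂ} (hc : ∀ n : ℕ, c + n ≠ 0) (n : ℕ) :
    c + 1 + n ≠ 0 := by
  have := hc (n + 1)
  push_cast at this
  rwa [add_assoc, add_comm 1 (n : ℂ)]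

/-- The coefficients of the power series of `kummerM a c`. -/
noncomputable def kummerCoeff (a c : ℂ) (n : ℕ) : ℂ := pochC a n / pochC c n / (n.factorial : ℂ)

theorem kummerM_eq_tsum (a c ζ : ℂ) : kummerM a c ζ = ∑' n : ℕ, kummerCoeff a c n * ζ ^ n := by
  refine tsum_congr fun n => ?_
  rw [kummerCoeff]
  ring

theorem kummerCoeff_zero (a c : ℂ) : kummerCoeff a c 0 = 1 := by
  simp [kummerCoeff, pochC]

theorem kummerCoeff_succ {c : ℂ} (hc : ∀ n : ℕ, c + n ≠ 0) (a : ℂ) (n : ℕ) :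
    (c + n) * (n + 1) * kummerCoeff a c (n + 1) = (a + n) * kummerCoeff a c n := by
  have h1 := hc n
  have h2 := pochC_ne_zero hc n
  have h3 : (n.factorial : ℂ) ≠ 0 := Nat.cast_ne_zero.mpr n.factorial_ne_zero
  have h4 : (n + 1 : ℂ) ≠ 0 := Nat.cast_add_one_ne_zero n
  simp only [kummerCoeff, pochC_succ, Nat.factorial_succ, Nat.cast_mul, Nat.cast_succ]
  field_simp

theorem kummerCoeff_succ_left {c : ℂ} (hc : ∀ n : ℕ, c + n ≠ 0) (a : ℂ) (n : ℕ) :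
    c * (n + 1) * kummerCoeff a c (n + 1) = a * kummerCoeff (a + 1) (c + 1) n := by
  have h1 : c ≠ 0 := by simpa using hc 0
  have h2 : pochC (c + 1) n ≠ 0 := pochC_ne_zero (add_one_add_natCast_ne_zero hc) n
  have h3 : (n.factorial : ℂ) ≠ 0 := Nat.cast_ne_zero.mpr n.factorial_ne_zero
  have h4 : (n + 1 : ℂ) ≠ 0 := Nat.cast_add_one_ne_zero n
  simp only [kummerCoeff, pochC_succ_left, Nat.factorial_succ, Nat.cast_mul, Nat.cast_succ]
  field_simp

theorem summable_kummerCoeff {c : ℂ} (hc : ∀ n : ℕ, c + n ≠ 0) (a ζ : ℂ) :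
    Summable fun n : ℕ => kummerCoeff a c n * ζ ^ n := by
  have hn : Tendsto (fun n : ℕ => (n : ℂ)) atTop (cobounded ℂ) := by
    rw [← tendsto_norm_atTop_iff_cobounded]
    simpa using tendsto_natCast_atTop_atTop (R := ℝ)
  have hinv (x : ℂ) : Tendsto (fun n : ℕ => (x + n)⁻¹) atTop (𝓝 0) :=
    tendsto_inv₀_cobounded.comp ((tendsto_const_add_cobounded x).comp hn)
  have hlim : Tendsto (fun n : ℕ => (1 + (a - c) * (c + n)⁻¹) * (ζ * (1 + (n : ℂ))⁻¹))
      atTop (𝓝 0) := by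
    simpa using (((hinv c).const_mul (a - c)).const_add 1).mul ((hinv 1).const_mul ζ)
  refine summable_of_ratio_norm_eventually_le (r := 1 / 2) (by norm_num) ?_
  have hev := hlim.norm.eventually (ge_mem_nhds (show ‖(0 : ℂ)‖ < 1 / 2 by norm_num))
  filter_upwards [hev] with n hn
  have h1 := hc n
  have h4 : (1 + n : ℂ) ≠ 0 := by
    rw [add_comm]
    exact Nat.cast_add_one_ne_zero n
  have heq : kummerCoeff a c (n + 1) * ζ ^ (n + 1) =
      (1 + (a - c) * (c + n)⁻¹) * (ζ * (1 + (n : ℂ))⁻¹) * (kummerCoeff a c n * ζ ^ n) := by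
    have := kummerCoeff_succ hc a n
    field_simp
    linear_combination (ζ * ζ ^ n) * this
  rw [heq, norm_mul]
  gcongr

theorem hasDerivAt_tsum_mul_pow {u : ℕ → ℂ} (hu : ∀ z : ℂ, Summable fun n => u n * z ^ n)
    (z : ℂ) :
    HasDerivAt (fun z => ∑' n, u n * z ^ n) (∑' n : ℕ, (n + 1) * u (n + 1) * z ^ n) z ∧
      Summable fun n : ℕ => (n + 1) * u (n + 1) * z ^ n := by
  set r : ℝ := ‖z‖ + 1 with hr
  have hr1 : 1 ≤ r := by
    have := norm_nonneg z
    linarith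
  have hbd : Summable fun n : ℕ => ‖u n * (2 * r : ℝ) ^ n‖ := (hu _).norm
  have hle : ∀ (n : ℕ) (y : ℂ), y ∈ Metric.ball (0 : ℂ) r →
      ‖u n * (n * y ^ (n - 1))‖ ≤ ‖u n * ((2 * r : ℝ) : ℂ) ^ n‖ := by
    intro n y hy
    have hy' : ‖y‖ ≤ r := by simpa using (Metric.mem_ball.mp hy).le
    simp only [norm_mul, norm_pow, Complex.norm_natCast, Complex.norm_real, Real.norm_eq_abs]
    rw [Nat.abs_ofNat, abs_of_pos (show 0 < r by linarith), mul_pow]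
    gcongr
    · exact_mod_cast Nat.lt_two_pow_self.le
    · calc ‖y‖ ^ (n - 1) ≤ r ^ (n - 1) := by gcongr
        _ ≤ r ^ n := pow_le_pow_right₀ hr1 (Nat.sub_le n 1)
  have hz : z ∈ Metric.ball (0 : ℂ) r := by simp [hr]
  have hD := hasDerivAt_tsum_of_isPreconnected hbd Metric.isOpen_ball
    (convex_ball (0 : ℂ) r).isPreconnected
    (fun n y _ => (hasDerivAt_pow n y).const_mul (u n)) hle hz (hu z) hz
  have hS : Summable fun n : ℕ => u n * (n * z ^ (n - 1)) :=
    Summable.of_norm_bounded hbd fun n => hle n z hz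
  have hcongr (n : ℕ) : u (n + 1) * ((n + 1 : ℕ) * z ^ (n + 1 - 1)) =
      (n + 1) * u (n + 1) * z ^ n := by
    rw [Nat.add_sub_cancel]
    push_cast
    ring
  have hS' := (summable_nat_add_iff 1).mpr hS
  refine ⟨?_, by simpa only [hcongr] using hS'⟩
  rw [hS.tsum_eq_zero_add] at hD
  simpa only [hcongr, Nat.cast_zero, zero_mul, mul_zero, zero_add] using hD

theorem kummerM_zero (a c : ℂ) : kummerM a c 0 = 1 := by
  rw [kummerM_eq_tsum, tsum_eq_single 0 (fun n hn => by simp [hn])]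
  simp [kummerCoeff_zero]

theorem hasDerivAt_kummerM {c : ℂ} (hc : ∀ n : ℕ, c + n ≠ 0) (a ζ : ℂ) :
    HasDerivAt (kummerM a c) (a / c * kummerM (a + 1) (c + 1) ζ) ζ := by
  have hc0 : c ≠ 0 := by simpa using hc 0
  rw [funext (kummerM_eq_tsum a c), kummerM_eq_tsum, ← tsum_mul_left]
  have hD := (hasDerivAt_tsum_mul_pow (summable_kummerCoeff hc a) ζ).1
  refine hD.congr_deriv (tsum_congr fun n => ?_)
  have := kummerCoeff_succ_left hc a n
  field_simp
  linear_combination ζ ^ n * this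

/-- The contiguity relation `c M(a,c,ζ) = ζ M'(a+1,c+1,ζ) + (c-ζ) M(a+1,c+1,ζ)`. -/
theorem mul_kummerM {c : ℂ} (hc : ∀ n : ℕ, c + n ≠ 0) (a ζ : ℂ) :
    c * kummerM a c ζ =
      ζ * ((a + 1) / (c + 1) * kummerM (a + 1 + 1) (c + 1 + 1) ζ) +
        (c - ζ) * kummerM (a + 1) (c + 1) ζ := by
  have hc1 := add_one_add_natCast_ne_zero hc
  set r := kummerCoeff (a + 1) (c + 1)
  obtain ⟨hD, hS⟩ := hasDerivAt_tsum_mul_pow (summable_kummerCoeff hc1 (a + 1)) ζ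
  rw [(hasDerivAt_kummerM hc1 (a + 1) ζ).unique (by
    rw [funext (kummerM_eq_tsum (a + 1) (c + 1))]
    exact hD)]
  have hr := summable_kummerCoeff hc1 (a + 1) ζ
  have ht := summable_kummerCoeff hc a ζ
  have hsplit : (c - ζ) * kummerM (a + 1) (c + 1) ζ =
      c * (1 + ∑' n : ℕ, r (n + 1) * ζ ^ (n + 1)) - ζ * ∑' n : ℕ, r n * ζ ^ n := by
    rw [kummerM_eq_tsum, sub_mul]
    congr 2
    rw [hr.tsum_eq_zero_add, kummerCoeff_zero]
    simp [r]
  have hr' := (summable_nat_add_iff 1).mpr hr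
  have ht' := (summable_nat_add_iff 1).mpr ht
  rw [hsplit, kummerM_eq_tsum, ht.tsum_eq_zero_add, kummerCoeff_zero]
  have key : c * ∑' n : ℕ, kummerCoeff a c (n + 1) * ζ ^ (n + 1) =
      ζ * ∑' n : ℕ, (n + 1) * r (n + 1) * ζ ^ n + c * ∑' n : ℕ, r (n + 1) * ζ ^ (n + 1) -
        ζ * ∑' n : ℕ, r n * ζ ^ n := by
    rw [← tsum_mul_left, ← tsum_mul_left, ← tsum_mul_left, ← tsum_mul_left,
      ← (hS.mul_left ζ).tsum_add (hr'.mul_left c),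
      ← ((hS.mul_left ζ).add (hr'.mul_left c)).tsum_sub (hr.mul_left ζ)]
    refine tsum_congr fun n => ?_
    have h4 : (n + 1 : ℂ) ≠ 0 := Nat.cast_add_one_ne_zero n
    have e1 := kummerCoeff_succ_left hc a n
    have e2 := kummerCoeff_succ hc1 (a + 1) n
    apply mul_left_cancel₀ h4
    linear_combination ζ ^ (n + 1) * (e1 - e2)
  linear_combination key

/-- Kummer's differential equation `ζ M'' + (c - ζ) M' = a M`. -/
theorem kummerM_ode {c : ℂ} (hc : ∀ n : ℕ, c + n ≠ 0) (a ζ : ℂ) :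
    ζ * (a / c * ((a + 1) / (c + 1) * kummerM (a + 1 + 1) (c + 1 + 1) ζ)) +
      (c - ζ) * (a / c * kummerM (a + 1) (c + 1) ζ) = a * kummerM a c ζ := by
  have hc0 : c ≠ 0 := by simpa using hc 0
  have h := mul_kummerM hc a ζ
  field_simp at h ⊢
  linear_combination (-a) * h

theorem exists_kummerM_derivatives {c : ℂ} (hc : ∀ n : ℕ, c + n ≠ 0) (a : ℂ) :
    ∃ R₁ R₂ : ℂ → ℂ,
      (∀ ζ, HasDerivAt (kummerM (a + 1) (c + 1)) (R₁ ζ) ζ) ∧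
      (∀ ζ, HasDerivAt R₁ (R₂ ζ) ζ) ∧
      (∀ ζ, c * kummerM a c ζ = ζ * R₁ ζ + (c - ζ) * kummerM (a + 1) (c + 1) ζ) ∧
      ∀ ζ, ζ * R₂ ζ + (c + 1 - ζ) * R₁ ζ = (a + 1) * kummerM (a + 1) (c + 1) ζ := by
  have hc1 := add_one_add_natCast_ne_zero hc
  have hc2 := add_one_add_natCast_ne_zero hc1
  exact ⟨_, _, hasDerivAt_kummerM hc1 (a + 1),
    fun ζ => (hasDerivAt_kummerM hc2 (a + 1 + 1) ζ).const_mul ((a + 1) / (c + 1)),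
    mul_kummerM hc a, kummerM_ode hc1 (a + 1)⟩

/-- `Y` has derivatives `Y₁`, `Y₂` off `{z ^ 2 = τ}` and solves
`(τ - z²) Y'' + 2 z Y' + (w² (τ - z²)² - 2) Y = 0` there. -/
def IsRegularizedSolution (τ w : ℂ) (Y Y₁ Y₂ : ℂ → ℂ) : Prop :=
  ∀ z : ℂ, z ^ 2 ≠ τ → HasDerivAt Y (Y₁ z) z ∧ HasDerivAt Y₁ (Y₂ z) z ∧
    (τ - z ^ 2) * Y₂ z + 2 * z * Y₁ z + (w ^ 2 * (τ - z ^ 2) ^ 2 - 2) * Y z = 0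

theorem exists_isRegularizedSolution {τ w : ℂ} {Y Y₁ : ℂ → ℂ}
    (h : ∀ z, ∃ y, HasDerivAt Y (Y₁ z) z ∧ HasDerivAt Y₁ y z ∧
      (τ - z ^ 2) * y + 2 * z * Y₁ z + (w ^ 2 * (τ - z ^ 2) ^ 2 - 2) * Y z = 0) :
    ∃ Y₂, IsRegularizedSolution τ w Y Y₁ Y₂ := by
  choose Y₂ hY₂ using h
  exact ⟨Y₂, fun z _ => hY₂ z⟩

theorem isPreconnected_sq_ne (τ : ℂ) : IsPreconnected {z : ℂ | z ^ 2 ≠ τ} := by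
  obtain ⟨s, rfl⟩ := IsAlgClosed.exists_pow_nat_eq τ (n := 2) two_pos
  have : {z : ℂ | z ^ 2 ≠ s ^ 2} = ({s, -s} : Set ℂ)ᶜ := by
    ext z
    simp [sq_eq_sq_iff_eq_or_eq_neg]
  rw [this]
  exact (((Set.toFinite {s, -s}).countable).isConnected_compl_of_one_lt_rank
    (by simp [Complex.rank_real_complex])).isPreconnected

theorem isOpen_sq_ne (τ : ℂ) : IsOpen {z : ℂ | z ^ 2 ≠ τ} :=
  isOpen_ne_fun (by fun_prop) continuous_const

theorem IsRegularizedSolution.exists_wronskian_eq {τ w : ℂ} {Y Y₁ Y₂ Z Z₁ Z₂ : ℂ → ℂ}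
    (hY : IsRegularizedSolution τ w Y Y₁ Y₂) (hZ : IsRegularizedSolution τ w Z Z₁ Z₂) :
    ∃ K : ℂ, ∀ z : ℂ, z ^ 2 ≠ τ → Y z * Z₁ z - Y₁ z * Z z = K * (τ - z ^ 2) := by
  have hder : ∀ z : ℂ, z ^ 2 ≠ τ →
      HasDerivAt (fun z => (Y z * Z₁ z - Y₁ z * Z z) / (τ - z ^ 2)) 0 z := by
    intro z hz
    obtain ⟨y1, y2, y3⟩ := hY z hz
    obtain ⟨z1, z2, z3⟩ := hZ z hz
    have hq : τ - z ^ 2 ≠ 0 := sub_ne_zero.mpr hz.symm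
    refine (((y1.mul z2).sub (y2.mul z1)).div ((hasDerivAt_pow 2 z).const_sub τ) hq).congr_deriv ?_
    simp only [Pi.mul_apply, Pi.sub_apply]
    rw [div_eq_zero_iff]
    left
    push_cast
    linear_combination Y z * z3 - Z z * y3
  obtain ⟨K, hK⟩ := (isOpen_sq_ne τ).exists_is_const_of_deriv_eq_zero (isPreconnected_sq_ne τ)
    (fun z hz => (hder z hz).differentiableAt.differentiableWithinAt)
    (fun z hz => (hder z hz).deriv)
  exact ⟨K, fun z hz => (div_eq_iff (sub_ne_zero.mpr (Ne.symm hz))).mp (hK z hz)⟩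

theorem IsRegularizedSolution.exists_eq_add {τ w k : ℂ} {Y Y₁ Y₂ Z Z₁ Z₂ V V₁ V₂ : ℂ → ℂ}
    (hY : IsRegularizedSolution τ w Y Y₁ Y₂) (hZ : IsRegularizedSolution τ w Z Z₁ Z₂)
    (hV : IsRegularizedSolution τ w V V₁ V₂) (hk : k ≠ 0)
    (hYZ : ∀ z : ℂ, z ^ 2 ≠ τ → Y z * Z₁ z - Y₁ z * Z z = k * (τ - z ^ 2)) :
    ∃ c₁ c₂ : ℂ, ∀ z : ℂ, z ^ 2 ≠ τ → V z = c₁ * Y z + c₂ * Z z := by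
  obtain ⟨K₁, h1⟩ := hV.exists_wronskian_eq hZ
  obtain ⟨K₂, h2⟩ := hY.exists_wronskian_eq hV
  refine ⟨K₁ / k, K₂ / k, fun z hz => ?_⟩
  have hq : τ - z ^ 2 ≠ 0 := sub_ne_zero.mpr hz.symm
  rw [div_mul_eq_mul_div, div_mul_eq_mul_div, ← add_div, eq_div_iff hk]
  apply mul_left_cancel₀ hq
  linear_combination Y z * h1 z hz + Z z * h2 z hz - V z * hYZ z hz

theorem hasDerivAt_comp_mul_sq {f : ℂ → ℂ} {f' w z : ℂ} (hf : HasDerivAt f f' (w * z ^ 2)) :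
    HasDerivAt (fun z => f (w * z ^ 2)) (f' * (w * (2 * z))) z := by
  have h : HasDerivAt (fun z : ℂ => w * z ^ 2) (w * (2 * z)) z := by
    simpa using (hasDerivAt_pow 2 z).const_mul w
  exact hf.comp z h

theorem hasDerivAt_exp_mul_sq_mul {f : ℂ → ℂ} {f' w z : ℂ} (hf : HasDerivAt f f' z) :
    HasDerivAt (fun z => exp (-w / 2 * z ^ 2) * f z)
      (exp (-w / 2 * z ^ 2) * (-w * z * f z + f')) z := by
  refine ((hasDerivAt_comp_mul_sq (hasDerivAt_exp _)).mul hf).congr_deriv ?_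
  ring

theorem isRegularizedSolution_even {τ w a : ℂ} (ha : 4 * a = -(1 + τ * w)) {S R R₁ R₂ : ℂ → ℂ}
    (hS : ∀ ζ, HasDerivAt S (2 * a * R ζ) ζ) (hR : ∀ ζ, HasDerivAt R (R₁ ζ) ζ)
    (hR₁ : ∀ ζ, HasDerivAt R₁ (R₂ ζ) ζ) (hSR : ∀ ζ, S ζ = 2 * ζ * R₁ ζ + (1 - 2 * ζ) * R ζ)
    (hode : ∀ ζ, ζ * R₂ ζ + (3 / 2 - ζ) * R₁ ζ = (a + 1) * R ζ) :
    ∃ Y₂, IsRegularizedSolution τ w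
      (fun z => exp (-w / 2 * z ^ 2) * (τ * S (w * z ^ 2) - 4 * a * z ^ 2 * R (w * z ^ 2)))
      (fun z => exp (-w / 2 * z ^ 2) * (-w * τ * z * S (w * z ^ 2) +
        (4 * a * w * z ^ 3 + 4 * a * τ * w * z - 8 * a * z) * R (w * z ^ 2) -
        8 * a * w * z ^ 3 * R₁ (w * z ^ 2))) Y₂ := by
  refine exists_isRegularizedSolution fun z => ?_
  have dS := hasDerivAt_comp_mul_sq (hS (w * z ^ 2))
  have dR := hasDerivAt_comp_mul_sq (hR (w * z ^ 2))
  have dR₁ := hasDerivAt_comp_mul_sq (hR₁ (w * z ^ 2))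
  have d1 := hasDerivAt_id' z
  have d2 := hasDerivAt_pow 2 z
  have d3 := hasDerivAt_pow 3 z
  refine ⟨_, ?_, hasDerivAt_exp_mul_sq_mul ((((d1.const_mul (-w * τ)).mul dS).add
    ((((d3.const_mul (4 * a * w)).add (d1.const_mul (4 * a * τ * w))).sub
      (d1.const_mul (8 * a))).mul dR)).sub ((d3.const_mul (8 * a * w)).mul dR₁)), ?_⟩
  · refine (hasDerivAt_exp_mul_sq_mul ((dS.const_mul τ).sub
      ((d2.const_mul (4 * a)).mul dR))).congr_deriv ?_
    simp only [Pi.mul_apply, Pi.sub_apply]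
    push_cast
    ring
  · simp only [Pi.sub_apply, Pi.add_apply, hSR]
    push_cast
    obtain rfl : a = -(1 + τ * w) / 4 := by linear_combination ha / 4
    linear_combination (exp (-w / 2 * z ^ 2) * (τ - z ^ 2) * 4 * (1 + τ * w) * w * z ^ 2) *
      hode (w * z ^ 2)

theorem isRegularizedSolution_odd {τ w c : ℂ} (hc : 4 * c = 1 - τ * w) {P Q Q₁ Q₂ : ℂ → ℂ}
    (hP : ∀ ζ, HasDerivAt P (2 / 3 * c * Q ζ) ζ) (hQ : ∀ ζ, HasDerivAt Q (Q₁ ζ) ζ)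
    (hQ₁ : ∀ ζ, HasDerivAt Q₁ (Q₂ ζ) ζ)
    (hPQ : ∀ ζ, P ζ = 2 / 3 * ζ * Q₁ ζ + (1 - 2 / 3 * ζ) * Q ζ)
    (hode : ∀ ζ, ζ * Q₂ ζ + (5 / 2 - ζ) * Q₁ ζ = (c + 1) * Q ζ) :
    ∃ Y₂, IsRegularizedSolution τ w
      (fun z => exp (-w / 2 * z ^ 2) * (z * P (w * z ^ 2) + w / 3 * z ^ 3 * Q (w * z ^ 2)))
      (fun z => exp (-w / 2 * z ^ 2) * ((1 - w * z ^ 2) * P (w * z ^ 2) +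
        ((4 / 3 * c * w + w) * z ^ 2 - w ^ 2 / 3 * z ^ 4) * Q (w * z ^ 2) +
        2 / 3 * w ^ 2 * z ^ 4 * Q₁ (w * z ^ 2))) Y₂ := by
  refine exists_isRegularizedSolution fun z => ?_
  have dP := hasDerivAt_comp_mul_sq (hP (w * z ^ 2))
  have dQ := hasDerivAt_comp_mul_sq (hQ (w * z ^ 2))
  have dQ₁ := hasDerivAt_comp_mul_sq (hQ₁ (w * z ^ 2))
  have d1 := hasDerivAt_id' z
  have d2 := hasDerivAt_pow 2 z
  have d3 := hasDerivAt_pow 3 z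
  have d4 := hasDerivAt_pow 4 z
  refine ⟨_, ?_, hasDerivAt_exp_mul_sq_mul (((((d2.const_mul w).const_sub 1).mul dP).add
    (((d2.const_mul (4 / 3 * c * w + w)).sub (d4.const_mul (w ^ 2 / 3))).mul dQ)).add
    ((d4.const_mul (2 / 3 * w ^ 2)).mul dQ₁)), ?_⟩
  · refine (hasDerivAt_exp_mul_sq_mul ((d1.mul dP).add
      ((d3.const_mul (w / 3)).mul dQ))).congr_deriv ?_
    simp only [Pi.mul_apply, Pi.add_apply]
    push_cast
    ring
  · simp only [Pi.sub_apply, hPQ]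
    push_cast
    obtain rfl : c = (1 - τ * w) / 4 := by linear_combination hc / 4
    linear_combination (exp (-w / 2 * z ^ 2) * (τ - z ^ 2) * (4 / 3 * w ^ 2 * z ^ 3)) *
      hode (w * z ^ 2)

theorem eIθ_seven_sq : eIθ (7 * Real.pi / 4) ^ 2 = -I := by
  rw [eIθ, ← exp_nat_mul]
  have : ((2 : ℕ) : ℂ) * (I * ((7 * Real.pi / 4 : ℝ) : ℂ)) =
      -(Real.pi / 2 * I) + ((2 : ℤ) : ℂ) * (2 * Real.pi * I) := by
    push_cast
    ring
  rw [this, exp_periodic.int_mul (2 : ℤ), exp_neg, exp_pi_div_two_mul_I, inv_I]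

theorem eIθ_three : eIθ (3 * Real.pi / 4) = -eIθ (7 * Real.pi / 4) := by
  have : I * ((7 * Real.pi / 4 : ℝ) : ℂ) = I * ((3 * Real.pi / 4 : ℝ) : ℂ) + Real.pi * I := by
    push_cast
    ring
  rw [eIθ, eIθ, this, exp_add, exp_pi_mul_I]
  ring

theorem half_add_natCast_ne_zero (n : ℕ) : (1 / 2 : ℂ) + n ≠ 0 := by
  have : (1 / 2 : ℝ) + n ≠ 0 := by positivity
  simpa using ofReal_ne_zero.mpr this

theorem isRegularizedSolution_sq_mul {τ w : ℂ} (hw : w ^ 2 = -I) {X : ℂ → ℂ}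
    (hX1 : ∀ z : ℂ, z ^ 2 ≠ τ → DifferentiableAt ℂ X z)
    (hX2 : ∀ z : ℂ, z ^ 2 ≠ τ → DifferentiableAt ℂ (deriv X) z)
    (hODE : ∀ z : ℂ, z ^ 2 ≠ τ →
      I * (τ - z ^ 2) * deriv (deriv X) z - 6 * I * z * deriv X z
        + ((τ - z ^ 2) ^ 2 - 6 * I) * X z = 0) :
    ∃ Y₁ Y₂, IsRegularizedSolution τ w (fun z => (τ - z ^ 2) ^ 2 * X z) Y₁ Y₂ := by
  refine ⟨fun z => (τ - z ^ 2) ^ 2 * deriv X z - 4 * z * (τ - z ^ 2) * X z,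
    fun z => (τ - z ^ 2) ^ 2 * deriv (deriv X) z - 8 * z * (τ - z ^ 2) * deriv X z +
      (8 * z ^ 2 - 4 * (τ - z ^ 2)) * X z, fun z hz => ?_⟩
  have dX := (hX1 z hz).hasDerivAt
  have dX' := (hX2 z hz).hasDerivAt
  have dq := (hasDerivAt_pow 2 z).const_sub τ
  have d1 := hasDerivAt_id' z
  refine ⟨((dq.pow 2).mul dX).congr_deriv ?_, (((dq.pow 2).mul dX').sub
    (((d1.const_mul 4).mul dq).mul dX)).congr_deriv ?_, ?_⟩
  · simp only [Pi.pow_apply]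
    push_cast
    ring
  · simp only [Pi.mul_apply, Pi.pow_apply]
    push_cast
    ring
  · rw [hw]
    linear_combination (-I * (τ - z ^ 2) ^ 2) * hODE z hz +
      (τ - z ^ 2) ^ 2 * ((τ - z ^ 2) * deriv (deriv X) z - 6 * z * deriv X z - 6 * X z) * I_sq

theorem statement0 (τ : ℂ) (X : ℂ → ℂ)
    (hX1 : ∀ z : ℂ, z ^ 2 ≠ τ → DifferentiableAt ℂ X z)
    (hX2 : ∀ z : ℂ, z ^ 2 ≠ τ → DifferentiableAt ℂ (deriv X) z)
    (hODE : ∀ z : ℂ, z ^ 2 ≠ τ →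
      Complex.I * (τ - z ^ 2) * deriv (deriv X) z - 6 * Complex.I * z * deriv X z
        + ((τ - z ^ 2) ^ 2 - 6 * Complex.I) * X z = 0) :
    ∃ c₁ c₂ : ℂ, ∀ z : ℂ, z ^ 2 ≠ τ → X z = c₁ * Xτ1 τ z + c₂ * Xτ2 τ z := by
  set w := eIθ (7 * Real.pi / 4) with hw
  set a : ℂ := -(1 + τ * w) / 4 with ha
  set c : ℂ := (1 - τ * w) / 4 with hc
  have hhalf := half_add_natCast_ne_zero
  have hhalf' := add_one_add_natCast_ne_zero hhalf
  obtain ⟨R₁, R₂, hR, hR₁, hSR, hRode⟩ := exists_kummerM_derivatives hhalf a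
  obtain ⟨Q₁, Q₂, hQ, hQ₁, hPQ, hQode⟩ := exists_kummerM_derivatives hhalf' c
  have hS := hasDerivAt_kummerM hhalf a
  have hP := hasDerivAt_kummerM hhalf' c
  have eb : a + 1 = (3 - τ * w) / 4 := by rw [ha]; ring
  have ed : c + 1 = (5 - τ * w) / 4 := by rw [hc]; ring
  have e3 : (1 / 2 : ℂ) + 1 = 3 / 2 := by norm_num
  have e5 : (3 / 2 : ℂ) + 1 = 5 / 2 := by norm_num
  simp only [e3, e5] at hR hSR hRode hQ hPQ hQode hS hP
  obtain ⟨Y₂, hY⟩ := isRegularizedSolution_even (τ := τ) (w := w) (a := a) (by rw [ha]; ring)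
    (fun ζ => (hS ζ).congr_deriv (by ring)) hR hR₁
    (fun ζ => by linear_combination 2 * hSR ζ) (fun ζ => by linear_combination hRode ζ)
  obtain ⟨Z₂, hZ⟩ := isRegularizedSolution_odd (τ := τ) (w := w) (c := c) (by rw [hc]; ring)
    (fun ζ => (hP ζ).congr_deriv (by ring)) hQ hQ₁
    (fun ζ => by linear_combination 2 / 3 * hPQ ζ) (fun ζ => by linear_combination hQode ζ)
  obtain ⟨V₁, V₂, hV⟩ := isRegularizedSolution_sq_mul eIθ_seven_sq hX1 hX2 hODE
  obtain ⟨k, hk⟩ := hY.exists_wronskian_eq hZ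
  have hk0 : k = 1 := by
    by_cases hτ : τ = 0
    · have ha' : a = -1 / 4 := by simp [ha, hτ]
      have hRc : Continuous (kummerM (a + 1) (3 / 2)) :=
        continuous_iff_continuousAt.mpr fun ζ => (hR ζ).continuousAt
      have hR₁c : Continuous R₁ := continuous_iff_continuousAt.mpr fun ζ => (hR₁ ζ).continuousAt
      have hPc : Continuous (kummerM c (3 / 2)) :=
        continuous_iff_continuousAt.mpr fun ζ => (hP ζ).continuousAt
      have hQc : Continuous (kummerM (c + 1) (5 / 2)) :=
        continuous_iff_continuousAt.mpr fun ζ => (hQ ζ).continuousAt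
      have hQ₁c : Continuous Q₁ := continuous_iff_continuousAt.mpr fun ζ => (hQ₁ ζ).continuousAt
      let G : ℂ → ℂ := fun z => exp (-w / 2 * z ^ 2) ^ 2 *
        ((-w * z ^ 2 * kummerM (a + 1) (3 / 2) (w * z ^ 2) +
            2 * kummerM (a + 1) (3 / 2) (w * z ^ 2) + 2 * w * z ^ 2 * R₁ (w * z ^ 2)) *
          (kummerM c (3 / 2) (w * z ^ 2) + w / 3 * z ^ 2 * kummerM (c + 1) (5 / 2) (w * z ^ 2)) -
        kummerM (a + 1) (3 / 2) (w * z ^ 2) * ((1 - w * z ^ 2) * kummerM c (3 / 2) (w * z ^ 2) +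
          ((4 / 3 * c * w + w) * z ^ 2 - w ^ 2 / 3 * z ^ 4) *
            kummerM (c + 1) (5 / 2) (w * z ^ 2) + 2 / 3 * w ^ 2 * z ^ 4 * Q₁ (w * z ^ 2)))
      have hG : Continuous G := by fun_prop
      have hGk : ∀ z : ℂ, z ≠ 0 → G z = k := by
        intro z hz
        have h := hk z (by simpa [hτ] using hz)
        simp only [ha', hτ] at h
        simp only [G, ha']
        apply mul_left_cancel₀ (pow_ne_zero 2 hz)
        linear_combination -h
      have hG0 : Tendsto G (𝓝[≠] 0) (𝓝 k) :=
        tendsto_const_nhds.congr' (eventually_mem_nhdsWithin.mono fun z hz => (hGk z hz).symm)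
      have := tendsto_nhds_unique hG0 (hG.continuousAt.tendsto.mono_left nhdsWithin_le_nhds)
      rw [this]
      simp [G, kummerM_zero]
      norm_num
    · have h := hk 0 (by simpa using Ne.symm hτ)
      simp only [ne_eq, OfNat.ofNat_ne_zero, not_false_eq_true, zero_pow, mul_zero, exp_zero,
        kummerM_zero] at h
      apply mul_right_cancel₀ hτ
      linear_combination -h
  obtain ⟨c₁, c₂, h⟩ := hY.exists_eq_add hZ hV (by simp [hk0]) hk
  refine ⟨c₁, c₂, fun z hz => ?_⟩
  have hq : τ - z ^ 2 ≠ 0 := sub_ne_zero.mpr hz.symm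
  have hexp : (1 / 2) * eIθ (3 * Real.pi / 4) * z ^ 2 = -w / 2 * z ^ 2 := by
    rw [eIθ_three]
    ring
  rw [Xτ1, Xτ2, hexp, ← hw, ← ha, ← hc, ← eb, ← ed]
  have h' := h z hz
  rw [← mul_div_cancel_left₀ (X z) (pow_ne_zero 2 hq), h']
  ring
end

section
/- Suppose τ ∈ ℂ with Im τ < 0 and W : ℝ → ℂ is infinitely differentiable, satisfies (τ − z²)²·W'(z) + i·(d³/dz³)[(τ − z²)·W(z)] = 0 for every z ∈ ℝ, and has limits W(z) → 0 as z → −∞ and W(z) → 1 as z → +∞. Then necessarily τ = e^{5πi/4} = −(1+i)/√2 and, for every z ∈ ℝ, W(z) = (1/2)·( 1 + erf(η(z)/√2) + √(2/π)·(η(z)/(1+η(z)²))·e^{−η(z)²/2} ), where η(z) = e^{−iπ/8}·z. -/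
open Complex Filter

/-- Straight-segment integral of a (typically entire) function from `a` to `b`. -/
noncomputable def lineInt (f : ℂ → ℂ) (a b : ℂ) : ℂ :=
  ∫ t in (0:ℝ)..1, (b - a) * f (a + (t : ℂ) * (b - a))

/-- The Gauss error function on `ℂ`. -/
noncomputable def cerf (ζ : ℂ) : ℂ :=
  ((2 / Real.sqrt Real.pi : ℝ) : ℂ) * lineInt (fun ω => Complex.exp (-ω ^ 2)) 0 ζ

/-- The rotation `η(z) = e^{-iπ/8} z`. -/
noncomputable def ηrot (z : ℝ) : ℂ := Complex.exp (-(Complex.I * (Real.pi / 8 : ℝ))) * (z : ℂ)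

/-- A Landau-type interpolation inequality on `[a, a + 2h]` in which the third derivative of `W` is
controlled by its lower derivatives. -/
lemma norm_deriv_add_norm_deriv_le {W V V₁ V₂ : ℝ → ℂ} {M K a h : ℝ}
    (hW : ∀ z, HasDerivAt W (V z) z) (hV : ∀ z, HasDerivAt V (V₁ z) z)
    (hV₁ : ∀ z, HasDerivAt V₁ (V₂ z) z) (hM : ∀ z, ‖W z‖ ≤ M) (hh : 0 < h) (hK1 : 1 ≤ K)
    (hK : K * h = 1 / 96)
    (hb : ∀ t ∈ Set.Icc a (a + 2 * h), ‖V₂ t‖ ≤ K * (‖V t‖ + ‖V₁ t‖)) :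
    ‖V a‖ + ‖V₁ a‖ ≤ 16 * M / h ^ 2 := by
  have hab : a ≤ a + 2 * h := by linarith
  have cV : Continuous V := continuous_iff_continuousAt.2 fun z => (hV z).continuousAt
  have cV₁ : Continuous V₁ := continuous_iff_continuousAt.2 fun z => (hV₁ z).continuousAt
  obtain ⟨t₀, ht₀, hmax⟩ := isCompact_Icc.exists_isMaxOn (Set.nonempty_Icc.2 hab)
    (cV.norm.add cV₁.norm).continuousOn
  set T := ‖V t₀‖ + ‖V₁ t₀‖ with hT
  have hmax' : ∀ t ∈ Set.Icc a (a + 2 * h), ‖V t‖ + ‖V₁ t‖ ≤ T := fun t ht => hmax ht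
  have hT0 : 0 ≤ T := by positivity
  have hKpos : 0 < K := by linarith
  have hh1 : h ≤ 1 / 96 := by nlinarith
  have e1 : ∀ t ∈ Set.Icc a (a + 2 * h), ‖V₁ t - V₁ a‖ ≤ T / 48 := by
    intro t ht
    have := norm_image_sub_le_of_norm_deriv_le_segment' (f := V₁) (f' := V₂) (C := K * T)
      (fun x _ => (hV₁ x).hasDerivWithinAt)
      (fun x hx => (hb x ⟨hx.1, hx.2.le⟩).trans
        (mul_le_mul_of_nonneg_left (hmax' x ⟨hx.1, hx.2.le⟩) hKpos.le)) t ht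
    refine this.trans ?_
    have h1 : t - a ≤ 2 * h := by linarith [ht.2]
    calc K * T * (t - a) ≤ K * T * (2 * h) := by gcongr
      _ = 2 * T * (K * h) := by ring
      _ = T / 48 := by rw [hK]; ring
  have e2 : ∀ t ∈ Set.Icc a (a + 2 * h), ‖V t - V a‖ ≤ 2 * h * T := by
    intro t ht
    have := norm_image_sub_le_of_norm_deriv_le_segment' (f := V) (f' := V₁) (C := T)
      (fun x _ => (hV x).hasDerivWithinAt)
      (fun x hx => by linarith [hmax' x ⟨hx.1, hx.2.le⟩, norm_nonneg (V x)]) t ht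
    refine this.trans ?_
    have h1 : t - a ≤ 2 * h := by linarith [ht.2]
    calc T * (t - a) ≤ T * (2 * h) := by gcongr
      _ = _ := by ring
  have e3 : ∀ t ∈ Set.Icc a (a + 2 * h), ‖V t - V a - (t - a : ℝ) * V₁ a‖ ≤ h * T / 24 := by
    intro t ht
    have := norm_image_sub_le_of_norm_deriv_le_segment'
      (f := fun t : ℝ => V t - V a - (t - a : ℝ) * V₁ a) (f' := fun t => V₁ t - V₁ a) (C := T / 48)
      (fun x _ => by
        have := ((hV x).sub_const (V a)).sub
          ((((hasDerivAt_id x).sub_const a).ofReal_comp).mul_const (V₁ a))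
        refine (this.congr_deriv ?_).hasDerivWithinAt
        simp)
      (fun x hx => e1 x ⟨hx.1, hx.2.le⟩) t ht
    simp only [sub_self, Complex.ofReal_zero, zero_mul, sub_zero] at this
    refine this.trans ?_
    have h1 : t - a ≤ 2 * h := by linarith [ht.2]
    calc T / 48 * (t - a) ≤ T / 48 * (2 * h) := by gcongr
      _ = _ := by ring
  have e4 : ∀ t ∈ Set.Icc a (a + 2 * h),
      ‖W t - W a - (t - a : ℝ) * V a - ((t - a) ^ 2 / 2 : ℝ) * V₁ a‖ ≤ h ^ 2 * T / 12 := by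
    intro t ht
    have := norm_image_sub_le_of_norm_deriv_le_segment'
      (f := fun t : ℝ => W t - W a - (t - a : ℝ) * V a - ((t - a) ^ 2 / 2 : ℝ) * V₁ a)
      (f' := fun t => V t - V a - (t - a : ℝ) * V₁ a) (C := h * T / 24)
      (fun x _ => by
        have := (((hW x).sub_const (W a)).sub
          ((((hasDerivAt_id x).sub_const a).ofReal_comp).mul_const (V a))).sub
          ((((((hasDerivAt_id x).sub_const a).pow 2).div_const 2).ofReal_comp).mul_const (V₁ a))
        refine (this.congr_deriv ?_).hasDerivWithinAt
        simp)
      (fun x hx => e3 x ⟨hx.1, hx.2.le⟩) t ht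
    simp only [sub_self, Complex.ofReal_zero, zero_mul, sub_zero, ne_eq, OfNat.ofNat_ne_zero,
      not_false_eq_true, zero_pow, zero_div] at this
    refine this.trans ?_
    have h1 : t - a ≤ 2 * h := by linarith [ht.2]
    calc h * T / 24 * (t - a) ≤ h * T / 24 * (2 * h) := by gcongr
      _ = _ := by ring
  have f1 := e4 (a + h) ⟨by linarith, by linarith⟩
  have f2 := e4 (a + 2 * h) ⟨by linarith, by linarith⟩
  rw [add_sub_cancel_left] at f1 f2
  set R₁ := W (a + h) - W a - (h : ℝ) * V a - (h ^ 2 / 2 : ℝ) * V₁ a with hR₁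
  set R₂ := W (a + 2 * h) - W a - (2 * h : ℝ) * V a - ((2 * h) ^ 2 / 2 : ℝ) * V₁ a with hR₂
  have g1 : h ^ 2 * ‖V₁ a‖ ≤ 4 * M + h ^ 2 * T / 4 := by
    have : ((h ^ 2 : ℝ) : ℂ) * V₁ a = W (a + 2 * h) - 2 * W (a + h) + W a - R₂ + 2 * R₁ := by
      rw [hR₁, hR₂]; push_cast; ring
    calc h ^ 2 * ‖V₁ a‖ = ‖((h ^ 2 : ℝ) : ℂ) * V₁ a‖ := by
          rw [norm_mul, Complex.norm_real, Real.norm_of_nonneg (by positivity)]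
      _ ≤ ‖W (a + 2 * h)‖ + 2 * ‖W (a + h)‖ + ‖W a‖ + ‖R₂‖ + 2 * ‖R₁‖ := by
          rw [this]
          refine (norm_add_le _ _).trans ?_
          refine add_le_add ((norm_sub_le _ _).trans ?_) (by simp)
          refine add_le_add ((norm_add_le _ _).trans ?_) le_rfl
          refine add_le_add ((norm_sub_le _ _).trans ?_) le_rfl
          simp
      _ ≤ _ := by linarith [hM (a + 2 * h), hM (a + h), hM a]
  have g2 : h * ‖V a‖ ≤ 2 * M + h ^ 2 / 2 * ‖V₁ a‖ + h ^ 2 * T / 12 := by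
    have : (h : ℂ) * V a = W (a + h) - W a - (h ^ 2 / 2 : ℝ) * V₁ a - R₁ := by
      rw [hR₁]; ring
    calc h * ‖V a‖ = ‖(h : ℂ) * V a‖ := by
          rw [norm_mul, Complex.norm_real, Real.norm_of_nonneg hh.le]
      _ ≤ ‖W (a + h)‖ + ‖W a‖ + h ^ 2 / 2 * ‖V₁ a‖ + ‖R₁‖ := by
          rw [this]
          refine (norm_sub_le _ _).trans ?_
          refine add_le_add ((norm_sub_le _ _).trans ?_) le_rfl
          refine add_le_add (norm_sub_le _ _) ?_
          rw [norm_mul, Complex.norm_real, Real.norm_of_nonneg (by positivity)]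
      _ ≤ _ := by linarith [hM (a + h), hM a]
  have hM0 : 0 ≤ M := (norm_nonneg _).trans (hM a)
  have g3 : T ≤ ‖V a‖ + ‖V₁ a‖ + 2 * h * T + T / 48 := by
    have h1 := e1 t₀ ht₀
    have h2 := e2 t₀ ht₀
    have h3 := norm_sub_norm_le (V t₀) (V a)
    have h4 := norm_sub_norm_le (V₁ t₀) (V₁ a)
    linarith
  set P := M / h ^ 2 with hP
  have hP0 : 0 ≤ P := by positivity
  have hMP : M = h ^ 2 * P := by rw [hP]; field_simp
  have k1 : ‖V₁ a‖ ≤ 4 * P + T / 4 := by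
    refine le_of_mul_le_mul_left (g1.trans_eq ?_) (pow_pos hh 2)
    rw [hMP]; ring
  have k2 : ‖V a‖ ≤ h * (2 * P + ‖V₁ a‖ / 2 + T / 12) := by
    refine le_of_mul_le_mul_left (g2.trans_eq ?_) hh
    rw [hMP]; ring
  have k3 : ‖V a‖ ≤ 2 * P + ‖V₁ a‖ / 2 + T / 12 :=
    k2.trans (mul_le_of_le_one_left (by positivity) (by linarith))
  have k4 : h * T ≤ 1 / 96 * T := by gcongr
  have k5 := hmax' a ⟨le_rfl, hab⟩
  rw [mul_div_assoc, ← hP]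
  linarith

/-- A polynomially bounded solution of `y'' = k y` with `Re k ≥ 1 / 2` vanishes. -/
lemma eq_zero_of_hasDerivAt_of_polynomial_bound {y D k : ℝ → ℂ} {C : ℝ} {n : ℕ}
    (hy : ∀ z, HasDerivAt y (D z) z) (hD : ∀ z, HasDerivAt D (k z * y z) z)
    (hk : ∀ z, 1 / 2 ≤ (k z).re) (hyb : ∀ z, ‖y z‖ ≤ C * (1 + z ^ 2) ^ n)
    (hDb : ∀ z, ‖D z‖ ≤ C * (1 + z ^ 2) ^ n) (z : ℝ) : y z = 0 := by
  have hlim : ∀ (C : ℝ) (n : ℕ),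
      Tendsto (fun z : ℝ => C * (1 + z ^ 2) ^ n * Real.exp (-z)) atTop (nhds 0) := by
    intro C n
    have h1 := (Real.tendsto_pow_mul_exp_neg_atTop_nhds_zero (2 * n)).const_mul (2 ^ n)
    rw [mul_zero] at h1
    have h2 : Tendsto (fun z : ℝ => (1 + z ^ 2) ^ n * Real.exp (-z)) atTop (nhds 0) := by
      refine tendsto_of_tendsto_of_tendsto_of_le_of_le' tendsto_const_nhds h1
        (Eventually.of_forall fun z => by positivity) ?_
      filter_upwards [eventually_ge_atTop 1] with z hz
      rw [← mul_assoc, pow_mul, ← mul_pow]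
      gcongr
      nlinarith
    simpa [mul_assoc] using h2.const_mul C
  set g : ℝ → ℝ := fun z => ‖y z‖ ^ 2 with hg
  set g' : ℝ → ℝ := fun z => 2 * inner ℝ (y z) (D z) with hg'
  have dg : ∀ z, HasDerivAt g (g' z) z := fun z => (hy z).norm_sq
  have dg' : ∀ z, HasDerivAt g' (2 * (inner ℝ (y z) (k z * y z) + inner ℝ (D z) (D z))) z :=
    fun z => ((hy z).inner ℝ (hD z)).const_mul 2
  have hgg : ∀ z, g z ≤ 2 * (inner ℝ (y z) (k z * y z) + inner ℝ (D z) (D z)) := by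
    intro z
    have h1 : inner ℝ (y z) (k z * y z) = (k z).re * ‖y z‖ ^ 2 := by
      rw [← Complex.normSq_eq_norm_sq, Complex.normSq_apply, Complex.inner]
      simp
      ring
    rw [h1, real_inner_self_eq_norm_sq]
    nlinarith [hk z, sq_nonneg ‖y z‖, sq_nonneg ‖D z‖, hg]
  have hgb : ∀ z, g z ≤ C ^ 2 * (1 + z ^ 2) ^ (2 * n) := by
    intro z
    calc g z ≤ (C * (1 + z ^ 2) ^ n) ^ 2 := by
          have := hyb z
          simp only [hg]; gcongr
      _ = _ := by ring
  have hgb' : ∀ z, |g' z| ≤ 2 * C ^ 2 * (1 + z ^ 2) ^ (2 * n) := by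
    intro z
    calc |g' z| ≤ 2 * (‖y z‖ * ‖D z‖) := by
          rw [hg', abs_mul, abs_two]
          gcongr
          exact abs_real_inner_le_norm _ _
      _ ≤ 2 * ((C * (1 + z ^ 2) ^ n) * (C * (1 + z ^ 2) ^ n)) := by
          have h0 := (norm_nonneg _).trans (hyb z)
          gcongr
          exacts [hyb z, hDb z]
      _ = _ := by ring
  have hp : ∀ z, g' z + g z ≤ 0 := by
    have dm : ∀ z, HasDerivAt (fun z => (g' z + g z) * Real.exp (-z))
        ((2 * (inner ℝ (y z) (k z * y z) + inner ℝ (D z) (D z)) - g z) * Real.exp (-z)) z := by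
      intro z
      refine (((dg' z).add (dg z)).mul (hasDerivAt_neg z).exp).congr_deriv ?_
      simp only [Pi.add_apply]
      ring
    have hm : Monotone fun z => (g' z + g z) * Real.exp (-z) :=
      monotone_of_hasDerivAt_nonneg dm fun z =>
        mul_nonneg (sub_nonneg.2 (hgg z)) (Real.exp_pos _).le
    have ht : Tendsto (fun z => (g' z + g z) * Real.exp (-z)) atTop (nhds 0) := by
      refine squeeze_zero_norm (fun z => ?_) (hlim (3 * C ^ 2) (2 * n))
      rw [norm_mul, Real.norm_of_nonneg (Real.exp_pos _).le, Real.norm_eq_abs]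
      gcongr
      have h0 : |g z| = g z := abs_of_nonneg (sq_nonneg _)
      linarith [abs_add_le (g' z) (g z), hgb z, hgb' z]
    intro z
    have := hm.ge_of_tendsto ht z
    exact nonpos_of_mul_nonpos_left this (Real.exp_pos _)
  have hgz : g z ≤ 0 := by
    have dm : ∀ z, HasDerivAt (fun z => -(g (-z) * Real.exp (-z)))
        ((g' (-z) + g (-z)) * Real.exp (-z)) z := by
      intro z
      refine (((dg (-z)).scomp z (hasDerivAt_neg z)).mul (hasDerivAt_neg z).exp).neg.congr_deriv ?_
      simp
      ring
    have hm : Antitone fun z => -(g (-z) * Real.exp (-z)) :=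
      antitone_of_hasDerivAt_nonpos dm fun z =>
        mul_nonpos_of_nonpos_of_nonneg (hp (-z)) (Real.exp_pos _).le
    have ht : Tendsto (fun z => -(g (-z) * Real.exp (-z))) atTop (nhds 0) := by
      rw [← neg_zero]
      refine (squeeze_zero (fun z => ?_) (fun z => ?_) (hlim (C ^ 2) (2 * n))).neg
      · exact mul_nonneg (sq_nonneg _) (Real.exp_pos _).le
      · gcongr
        simpa using hgb (-z)
    have := hm.le_of_tendsto ht (-z)
    rw [neg_neg] at this
    exact nonpos_of_mul_nonpos_left (by linarith) (Real.exp_pos _)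
  exact norm_eq_zero.1 (pow_eq_zero_iff two_ne_zero |>.1 (le_antisymm hgz (sq_nonneg _)))

lemma norm_sub_sq_ge (τ : ℂ) (z : ℝ) : -τ.im ≤ ‖τ - (z : ℂ) ^ 2‖ := by
  have := Complex.abs_im_le_norm (τ - (z : ℂ) ^ 2)
  rw [← Complex.ofReal_pow, Complex.sub_im, Complex.ofReal_im, sub_zero] at this
  rw [← Complex.ofReal_pow]
  exact (neg_le_abs _).trans this

lemma sub_sq_ne_zero {τ : ℂ} (hτ : τ.im < 0) (z : ℝ) : τ - (z : ℂ) ^ 2 ≠ 0 :=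
  norm_pos_iff.1 ((neg_pos.2 hτ).trans_le (norm_sub_sq_ge τ z))

lemma norm_sub_sq_le (τ : ℂ) (z : ℝ) : ‖τ - (z : ℂ) ^ 2‖ ≤ (‖τ‖ + 1) * (1 + z ^ 2) := by
  refine (norm_sub_le _ _).trans ?_
  rw [norm_pow, Complex.norm_real, Real.norm_eq_abs, sq_abs]
  nlinarith [norm_nonneg τ, sq_nonneg z, mul_nonneg (norm_nonneg τ) (sq_nonneg z)]

lemma abs_le_one_add_sq (z : ℝ) : |z| ≤ 1 + z ^ 2 := by
  nlinarith [sq_nonneg (|z| - 1), sq_abs z]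

/-- Bounded solutions of the equation have polynomially bounded derivatives. -/
lemma exists_polynomial_bound {τ : ℂ} (hτ : τ.im < 0) {W V V₁ V₂ : ℝ → ℂ} {M : ℝ}
    (hW : ∀ z, HasDerivAt W (V z) z) (hV : ∀ z, HasDerivAt V (V₁ z) z)
    (hV₁ : ∀ z, HasDerivAt V₁ (V₂ z) z) (hM : ∀ z, ‖W z‖ ≤ M)
    (hE : ∀ z : ℝ, (τ - (z : ℂ) ^ 2) ^ 2 * V z
      + I * ((τ - (z : ℂ) ^ 2) * V₂ z - 6 * z * V₁ z - 6 * V z) = 0) :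
    ∃ C : ℝ, ∀ z, ‖V z‖ + ‖V₁ z‖ ≤ C * (1 + z ^ 2) ^ 2 := by
  set δ := -τ.im with hδ
  have hδ0 : 0 < δ := neg_pos.2 hτ
  set C₀ := 6 / δ + ‖τ‖ + 1 with hC₀
  have hC₀1 : 1 ≤ C₀ := by
    have : 0 ≤ 6 / δ := by positivity
    linarith [norm_nonneg τ]
  have hV₂ : ∀ t, ‖V₂ t‖ ≤ C₀ * (1 + t ^ 2) * (‖V t‖ + ‖V₁ t‖) := by
    intro t
    have hq := sub_sq_ne_zero hτ t
    have e : V₂ t = 6 * t / (τ - (t : ℂ) ^ 2) * V₁ t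
        + (6 / (τ - (t : ℂ) ^ 2) + I * (τ - (t : ℂ) ^ 2)) * V t := by
      field_simp
      linear_combination (-I) * hE t +
        (-6 * t * V₁ t - 6 * V t + (τ - (t : ℂ) ^ 2) * V₂ t) * Complex.I_sq
    have hqi : 6 / ‖τ - (t : ℂ) ^ 2‖ ≤ 6 / δ := by
      gcongr
      exact norm_sub_sq_ge τ t
    have h1 : ‖6 * t / (τ - (t : ℂ) ^ 2)‖ ≤ C₀ * (1 + t ^ 2) := by
      calc ‖6 * t / (τ - (t : ℂ) ^ 2)‖ = 6 / ‖τ - (t : ℂ) ^ 2‖ * |t| := by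
            simp [div_mul_eq_mul_div]
        _ ≤ C₀ * (1 + t ^ 2) := by
            gcongr
            · linarith [norm_nonneg τ]
            · exact abs_le_one_add_sq t
    have h2 : ‖6 / (τ - (t : ℂ) ^ 2) + I * (τ - (t : ℂ) ^ 2)‖ ≤ C₀ * (1 + t ^ 2) := by
      refine (norm_add_le _ _).trans ?_
      have : ‖6 / (τ - (t : ℂ) ^ 2)‖ ≤ 6 / δ * (1 + t ^ 2) := by
        rw [norm_div]
        simp only [RCLike.norm_ofNat]
        refine hqi.trans (le_mul_of_one_le_right (by positivity) (by nlinarith))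
      rw [norm_mul, Complex.norm_I, one_mul, hC₀, add_assoc, add_mul]
      exact add_le_add this (norm_sub_sq_le τ t)
    calc ‖V₂ t‖ ≤ C₀ * (1 + t ^ 2) * ‖V₁ t‖ + C₀ * (1 + t ^ 2) * ‖V t‖ := by
          rw [e]
          refine (norm_add_le _ _).trans ?_
          rw [norm_mul, norm_mul]
          gcongr
      _ = _ := by ring
  refine ⟨16 * M * (288 * C₀) ^ 2, fun a => ?_⟩
  set K := 3 * C₀ * (1 + a ^ 2) with hK
  have hK1 : 1 ≤ K := by nlinarith [sq_nonneg a]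
  have hK0 : 0 < K := by linarith
  have key := norm_deriv_add_norm_deriv_le (a := a) (K := K) (h := 1 / (96 * K)) hW hV hV₁ hM
    (by positivity) hK1 (by field_simp) (by
      intro t ht
      refine (hV₂ t).trans ?_
      have h1 : 1 / (96 * K) ≤ 1 / 96 := by
        gcongr
        linarith
      have h2 : (t - a) ^ 2 ≤ 1 := by
        have := ht.1
        have := ht.2
        rw [sq_le_one_iff_abs_le_one, abs_le]
        constructor <;> linarith
      have h3 : 1 + t ^ 2 ≤ 3 * (1 + a ^ 2) := by
        nlinarith [sq_nonneg (t - 2 * a)]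
      rw [hK, mul_comm 3 C₀, mul_assoc C₀ 3]
      gcongr)
  refine key.trans_eq ?_
  rw [hK]
  field_simp
  ring

/-- A bounded solution is annihilated by a first-order operator, and `τ` is determined. -/
lemma first_order_of_bounded {τ c : ℂ} (hτ : τ.im < 0) (hc : c ^ 2 = -I) (hcre : 1 / 2 ≤ c.re)
    {W V V₁ V₂ : ℝ → ℂ} {M : ℝ}
    (hW : ∀ z, HasDerivAt W (V z) z) (hV : ∀ z, HasDerivAt V (V₁ z) z)
    (hV₁ : ∀ z, HasDerivAt V₁ (V₂ z) z) (hM : ∀ z, ‖W z‖ ≤ M)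
    (hE : ∀ z : ℝ, (τ - (z : ℂ) ^ 2) ^ 2 * V z
      + I * ((τ - (z : ℂ) ^ 2) * V₂ z - 6 * z * V₁ z - 6 * V z) = 0) (z : ℝ) :
    (τ - (z : ℂ) ^ 2) * V₁ z - 4 * z * V z + c * z * (τ - (z : ℂ) ^ 2) * V z = 0 ∧
      (c * τ + 1) * V z = 0 := by
  obtain ⟨C, hC⟩ := exists_polynomial_bound hτ hW hV hV₁ hM hE
  set y : ℝ → ℂ := fun z => -I * c * z * (τ - (z : ℂ) ^ 2) * V₁ z
    + (4 * I * c * z ^ 2 + (τ - (z : ℂ) ^ 2) ^ 2 + I * c * (τ - (z : ℂ) ^ 2)) * V z with hy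
  set D : ℝ → ℂ := fun z => (τ - (z : ℂ) ^ 2) ^ 2 * V₁ z - 4 * z * (τ - (z : ℂ) ^ 2) * V z
    + c * z * (τ - (z : ℂ) ^ 2) ^ 2 * V z with hD
  have dz : ∀ z : ℝ, HasDerivAt (fun z : ℝ => (z : ℂ)) 1 z :=
    fun z => (hasDerivAt_id z).ofReal_comp
  have dq : ∀ z : ℝ, HasDerivAt (fun z : ℝ => τ - (z : ℂ) ^ 2) (-2 * z) z := by
    intro z
    refine (((dz z).pow 2).const_sub τ).congr_deriv ?_
    simp
  have dy : ∀ z, HasDerivAt y (D z) z := by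
    intro z
    have := ((((dz z).const_mul (-I * c)).mul (dq z)).mul (hV₁ z)).add
      ((((((dz z).pow 2).const_mul (4 * I * c)).add ((dq z).pow 2)).add
        ((dq z).const_mul (I * c))).mul (hV z))
    refine this.congr_deriv ?_
    simp only [hD, Pi.mul_apply, Pi.add_apply, Pi.pow_apply]
    push_cast
    linear_combination (-c * z) * hE z
  have hIc : I ^ 3 * c ^ 2 = -1 := by
    rw [hc]
    linear_combination (1 - I ^ 2) * Complex.I_sq
  have dD : ∀ z : ℝ, HasDerivAt D (I * (τ - (z : ℂ) ^ 2 - 2 * I * c) * y z) z := by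
    intro z
    have := ((((dq z).pow 2).mul (hV₁ z)).sub
      ((((dz z).const_mul 4).mul (dq z)).mul (hV z))).add
        ((((dz z).const_mul c).mul ((dq z).pow 2)).mul (hV z))
    refine this.congr_deriv ?_
    simp only [hy, Pi.mul_apply, Pi.pow_apply]
    push_cast
    set q := τ - (z : ℂ) ^ 2
    linear_combination (-I * q) * hE z
      + (q ^ 2 * V₂ z + (c * z * q ^ 2 - 6 * z * q) * V₁ z
        + (c * q ^ 2 - 4 * c * z ^ 2 * q - 6 * q) * V z) * Complex.I_sq
      + (-2 * z * q * V₁ z + (8 * z ^ 2 + 2 * q) * V z) * hIc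
  have hre : ∀ z : ℝ, 1 / 2 ≤ (I * (τ - (z : ℂ) ^ 2 - 2 * I * c)).re := by
    intro z
    rw [← Complex.ofReal_pow]
    simp [-Complex.ofReal_pow]
    linarith
  have hcn : ‖c‖ = 1 := by
    have : ‖c‖ ^ 2 = 1 := by rw [← norm_pow, hc]; simp
    exact (pow_eq_one_iff_of_nonneg (norm_nonneg c) two_ne_zero).1 this
  set B := ‖τ‖ + 1 with hB
  have hB1 : 1 ≤ B := by linarith [norm_nonneg τ]
  have hC0 : 0 ≤ C := by
    have := (add_nonneg (norm_nonneg _) (norm_nonneg _)).trans (hC 0)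
    simpa using this
  have hVb : ∀ z, ‖V z‖ ≤ C * (1 + z ^ 2) ^ 2 := fun z => by linarith [hC z, norm_nonneg (V₁ z)]
  have hV₁b : ∀ z, ‖V₁ z‖ ≤ C * (1 + z ^ 2) ^ 2 := fun z => by linarith [hC z, norm_nonneg (V z)]
  have hyb : ∀ z, ‖y z‖ ≤ 7 * B ^ 2 * C * (1 + z ^ 2) ^ 5 := by
    intro z
    have hs : 1 ≤ 1 + z ^ 2 := by nlinarith
    have hz := abs_le_one_add_sq z
    have hq := norm_sub_sq_le τ z
    have h1 := hVb z
    have h2 := hV₁b z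
    rw [← hB] at hq
    set s := 1 + z ^ 2
    calc ‖y z‖ ≤ |z| * ‖τ - (z : ℂ) ^ 2‖ * ‖V₁ z‖
          + (4 * z ^ 2 + ‖τ - (z : ℂ) ^ 2‖ ^ 2 + ‖τ - (z : ℂ) ^ 2‖) * ‖V z‖ := by
          refine (norm_add_le _ _).trans (add_le_add ?_ ?_)
          · simp [hcn]
          · rw [norm_mul]
            gcongr
            refine (norm_add₃_le).trans ?_
            simp [hcn]
      _ ≤ s * (B * s) * (C * s ^ 2) + (4 * s + (B * s) ^ 2 + B * s) * (C * s ^ 2) := by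
          gcongr
          linarith
      _ ≤ 7 * B ^ 2 * C * s ^ 5 := by
          have e1 : s ^ 3 ≤ s ^ 5 := pow_le_pow_right₀ hs (by norm_num)
          have e2 : s ^ 4 ≤ s ^ 5 := pow_le_pow_right₀ hs (by norm_num)
          have e3 : B ≤ B ^ 2 := by nlinarith
          have e4 : 1 ≤ B ^ 2 := by nlinarith
          calc _ = B * C * s ^ 4 + 4 * C * s ^ 3 + B ^ 2 * C * s ^ 4 + B * C * s ^ 3 := by ring
            _ ≤ B ^ 2 * C * s ^ 5 + 4 * (B ^ 2 * C) * s ^ 5 + B ^ 2 * C * s ^ 5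
                + B ^ 2 * C * s ^ 5 := by
                gcongr
                exact le_mul_of_one_le_left hC0 e4
            _ = _ := by ring
  have hDb : ∀ z, ‖D z‖ ≤ 7 * B ^ 2 * C * (1 + z ^ 2) ^ 5 := by
    intro z
    have hs : 1 ≤ 1 + z ^ 2 := by nlinarith
    have hz := abs_le_one_add_sq z
    have hq := norm_sub_sq_le τ z
    have h1 := hVb z
    have h2 := hV₁b z
    rw [← hB] at hq
    set s := 1 + z ^ 2
    calc ‖D z‖ ≤ ‖τ - (z : ℂ) ^ 2‖ ^ 2 * ‖V₁ z‖ + 4 * |z| * ‖τ - (z : ℂ) ^ 2‖ * ‖V z‖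
          + |z| * ‖τ - (z : ℂ) ^ 2‖ ^ 2 * ‖V z‖ := by
          refine (norm_add_le _ _).trans (add_le_add ((norm_sub_le _ _).trans ?_) ?_)
          · simp
          · simp [hcn]
      _ ≤ (B * s) ^ 2 * (C * s ^ 2) + 4 * s * (B * s) * (C * s ^ 2)
          + s * (B * s) ^ 2 * (C * s ^ 2) := by
          gcongr
      _ ≤ 7 * B ^ 2 * C * s ^ 5 := by
          have e2 : s ^ 4 ≤ s ^ 5 := pow_le_pow_right₀ hs (by norm_num)
          have e3 : B ≤ B ^ 2 := by nlinarith
          have e5 : 0 ≤ B ^ 2 * C * s ^ 5 := by positivity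
          calc _ = B ^ 2 * C * s ^ 4 + 4 * (B * C * s ^ 4) + B ^ 2 * C * s ^ 5 := by ring
            _ ≤ B ^ 2 * C * s ^ 5 + 4 * (B ^ 2 * C * s ^ 5) + B ^ 2 * C * s ^ 5 := by
                gcongr
            _ ≤ _ := by linarith
  have hy0 := eq_zero_of_hasDerivAt_of_polynomial_bound dy dD hre hyb hDb
  have hD0 : D z = 0 := by
    have : y = fun _ => 0 := funext hy0
    have h := dy z
    rw [this] at h
    exact h.unique (hasDerivAt_const z 0)
  have hq := sub_sq_ne_zero hτ z
  have h1 : (τ - (z : ℂ) ^ 2) * V₁ z - 4 * z * V z + c * z * (τ - (z : ℂ) ^ 2) * V z = 0 := by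
    refine (mul_eq_zero.1 ?_).resolve_left hq
    rw [← hD0]
    simp only [hD]
    ring
  refine ⟨h1, ?_⟩
  have hy0z := hy0 z
  simp only [hy] at hy0z
  have h2 : (τ - (z : ℂ) ^ 2) * (c * (c * τ + 1) * V z) = 0 := by
    linear_combination (-I) * hy0z + c * z * h1 + (-c * z * (τ - (z : ℂ) ^ 2) * V₁ z
      + (4 * c * z ^ 2 + c * (τ - (z : ℂ) ^ 2)) * V z) * Complex.I_sq
      + (τ - (z : ℂ) ^ 2) ^ 2 * V z * hc
  have hc0 : c ≠ 0 := by
    rintro rfl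
    norm_num at hcre
  have h3 := (mul_eq_zero.1 h2).resolve_left hq
  rw [mul_assoc] at h3
  exact (mul_eq_zero.1 h3).resolve_left hc0

/-- The square `e^{-iπ/4}` of the rotation factor of `ηrot`. -/
noncomputable def rotSq : ℂ := Complex.exp (-(I * (Real.pi / 4 : ℝ)))

lemma rotSq_eq : rotSq = (1 - I) / (Real.sqrt 2 : ℝ) := by
  have h : -(I * (Real.pi / 4 : ℝ)) = ((-(Real.pi / 4) : ℝ) : ℂ) * I := by push_cast; ring
  have h2 : ((Real.sqrt 2 : ℝ) : ℂ) ≠ 0 := by simp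
  have h3 : ((Real.sqrt 2 : ℝ) : ℂ) ^ 2 = 2 := by
    rw [← Complex.ofReal_pow, Real.sq_sqrt (by norm_num)]; norm_num
  rw [rotSq, h, Complex.exp_mul_I, ← Complex.ofReal_cos, ← Complex.ofReal_sin, Real.cos_neg,
    Real.sin_neg, Real.cos_pi_div_four, Real.sin_pi_div_four, eq_div_iff h2]
  push_cast
  linear_combination (1 - I) / 2 * h3

lemma rotSq_sq : rotSq ^ 2 = -I := by
  have h3 : ((Real.sqrt 2 : ℝ) : ℂ) ^ 2 = 2 := by
    rw [← Complex.ofReal_pow, Real.sq_sqrt (by norm_num)]; norm_num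
  rw [rotSq_eq, div_pow, h3]
  linear_combination (1 / 2) * Complex.I_sq

lemma rotSq_re : 1 / 2 ≤ rotSq.re := by
  rw [rotSq_eq, Complex.div_ofReal_re]
  simp only [Complex.sub_re, Complex.one_re, Complex.I_re, sub_zero]
  gcongr
  rw [Real.sqrt_le_left (by norm_num)]
  norm_num

lemma ηrot_sq (z : ℝ) : ηrot z ^ 2 = rotSq * (z : ℂ) ^ 2 := by
  rw [ηrot, mul_pow, ← Complex.exp_nat_mul, rotSq]
  congr 2
  push_cast
  ring

lemma one_add_rotSq_mul_re (z : ℝ) : 1 + z ^ 2 / 2 ≤ (1 + rotSq * (z : ℂ) ^ 2).re := by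
  rw [← Complex.ofReal_pow, Complex.add_re, Complex.re_mul_ofReal, Complex.one_re]
  nlinarith [rotSq_re, sq_nonneg z]

lemma one_add_rotSq_mul_ne_zero (z : ℝ) : 1 + rotSq * (z : ℂ) ^ 2 ≠ 0 := by
  intro h
  have := one_add_rotSq_mul_re z
  rw [h, Complex.zero_re] at this
  nlinarith [sq_nonneg z]

lemma ηrot_eq (z : ℝ) : ηrot z = ηrot 1 * z := by simp [ηrot]

lemma sqrt_two_div_pi : ((Real.sqrt (2 / Real.pi) : ℝ) : ℂ)
    = (Real.sqrt 2 : ℝ) / (Real.sqrt Real.pi : ℝ) := by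
  rw [Real.sqrt_div (by norm_num), Complex.ofReal_div]

lemma cerf_ηrot (z : ℝ) : cerf (ηrot z / (Real.sqrt 2 : ℝ))
    = (Real.sqrt (2 / Real.pi) : ℝ) * ηrot 1
      * ∫ s in (0:ℝ)..z, Complex.exp (-(rotSq / 2) * (s : ℂ) ^ 2) := by
  have h2 : ((Real.sqrt 2 : ℝ) : ℂ) ≠ 0 := by simp
  have h3 : ((Real.sqrt 2 : ℝ) : ℂ) ^ 2 = 2 := by
    rw [← Complex.ofReal_pow, Real.sq_sqrt (by norm_num)]; norm_num
  have hs := intervalIntegral.smul_integral_comp_mul_right (a := 0) (b := 1)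
    (fun s : ℝ => Complex.exp (-(rotSq / 2) * (s : ℂ) ^ 2)) z
  rw [zero_mul, one_mul] at hs
  rw [cerf, lineInt, ← hs, sqrt_two_div_pi, Complex.real_smul, sub_zero,
    intervalIntegral.integral_const_mul, ηrot_eq z]
  have he : ∀ t : ℝ, -(0 + (t : ℂ) * (ηrot 1 * z / (Real.sqrt 2 : ℝ))) ^ 2
      = -(rotSq / 2) * ((t * z : ℝ) : ℂ) ^ 2 := by
    intro t
    have := ηrot_sq 1
    rw [zero_add, mul_pow, div_pow, mul_pow, h3, this]
    push_cast
    ring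
  simp only [he]
  push_cast
  have hpi : ((Real.sqrt Real.pi : ℝ) : ℂ) ≠ 0 := by simp [Real.pi_pos.le, Real.pi_ne_zero]
  field_simp
  rw [h3]
  ring

/-- The odd profile whose affine images are the solutions of the equation. -/
noncomputable def profile (z : ℝ) : ℂ :=
  cerf (ηrot z / (Real.sqrt 2 : ℝ))
    + ((Real.sqrt (2 / Real.pi) : ℝ) : ℂ) * (ηrot z / (1 + ηrot z ^ 2))
      * Complex.exp (-(ηrot z) ^ 2 / 2)

lemma hasDerivAt_profile (z : ℝ) : HasDerivAt profile
    (2 * (Real.sqrt (2 / Real.pi) : ℝ) * ηrot 1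
      * (Complex.exp (-(rotSq / 2) * (z : ℂ) ^ 2) / (1 + rotSq * (z : ℂ) ^ 2) ^ 2)) z := by
  have hf : profile = fun z => (Real.sqrt (2 / Real.pi) : ℝ) * ηrot 1
      * ((∫ s in (0:ℝ)..z, Complex.exp (-(rotSq / 2) * (s : ℂ) ^ 2))
        + z / (1 + rotSq * (z : ℂ) ^ 2) * Complex.exp (-(rotSq / 2) * (z : ℂ) ^ 2)) := by
    ext z
    rw [profile, cerf_ηrot, ηrot_sq, ηrot_eq z,
      show -(rotSq * (z : ℂ) ^ 2) / 2 = -(rotSq / 2) * (z : ℂ) ^ 2 by ring]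
    ring
  have hcont : Continuous fun s : ℝ => Complex.exp (-(rotSq / 2) * (s : ℂ) ^ 2) := by fun_prop
  have dz : HasDerivAt (fun z : ℝ => (z : ℂ)) 1 z := (hasDerivAt_id z).ofReal_comp
  have d1 := intervalIntegral.integral_hasDerivAt_right (hcont.intervalIntegrable 0 z)
    (hcont.stronglyMeasurableAtFilter _ _) hcont.continuousAt
  have d2 := dz.div (((dz.pow 2).const_mul rotSq).const_add 1) (one_add_rotSq_mul_ne_zero z)
  have d3 := ((dz.pow 2).const_mul (-(rotSq / 2))).cexp
  rw [hf]
  refine ((d1.add (d2.mul d3)).const_mul _).congr_deriv ?_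
  have h0 := one_add_rotSq_mul_ne_zero z
  simp only [Pi.div_apply, Pi.pow_apply]
  push_cast
  field_simp
  ring

lemma profile_neg (z : ℝ) : profile (-z) = -profile z := by
  have h : ηrot (-z) = -ηrot z := by simp [ηrot]
  have h2 : ∀ ζ, cerf (-ζ) = -cerf ζ := by
    intro ζ
    simp [cerf, lineInt]
  rw [profile, profile, h, neg_div, h2, neg_sq]
  ring

lemma tendsto_profile_atTop : Tendsto profile atTop (nhds 1) := by
  have hre : 0 < (rotSq / 2).re := by
    have := rotSq_re
    simp
    linarith
  have hpi : ((Real.sqrt Real.pi : ℝ) : ℂ) ≠ 0 := by simp [Real.pi_pos.le, Real.pi_ne_zero]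
  have hpi2 : ((Real.sqrt Real.pi : ℝ) : ℂ) ^ 2 = Real.pi := by
    rw [← Complex.ofReal_pow, Real.sq_sqrt Real.pi_pos.le]
  have h2 : ((Real.sqrt 2 : ℝ) : ℂ) ≠ 0 := by simp
  have h3 : ((Real.sqrt 2 : ℝ) : ℂ) ^ 2 = 2 := by
    rw [← Complex.ofReal_pow, Real.sq_sqrt (by norm_num)]; norm_num
  have hη0 : ηrot 1 ≠ 0 := by simp [ηrot]
  have hη2 : ηrot 1 ^ 2 = rotSq := by rw [ηrot_sq]; simp
  have hηre : 0 < (ηrot 1)⁻¹.re := by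
    have : (ηrot 1)⁻¹ = Complex.exp (((Real.pi / 8 : ℝ) : ℂ) * I) := by
      rw [ηrot, Complex.ofReal_one, mul_one, ← Complex.exp_neg, neg_neg, mul_comm]
    rw [this, Complex.exp_ofReal_mul_I_re]
    exact Real.cos_pos_of_mem_Ioo ⟨by linarith [Real.pi_pos], by linarith [Real.pi_pos]⟩
  have hlim := (MeasureTheory.intervalIntegral_tendsto_integral_Ioi (0 : ℝ)
    (integrable_cexp_neg_mul_sq hre).integrableOn tendsto_id).const_mul
    ((Real.sqrt (2 / Real.pi) : ℝ) * ηrot 1)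
  have hval : (Real.sqrt (2 / Real.pi) : ℝ) * ηrot 1
      * ∫ x in Set.Ioi (0 : ℝ), Complex.exp (-(rotSq / 2) * (x : ℂ) ^ 2) = 1 := by
    have e : (Real.pi : ℂ) / (rotSq / 2)
        = ((Real.sqrt 2 * Real.sqrt Real.pi : ℝ) * (ηrot 1)⁻¹) ^ 2 := by
      rw [← hη2]
      push_cast
      rw [mul_pow, mul_pow, h3, hpi2]
      field_simp
    have hpos : 0 < (((Real.sqrt 2 * Real.sqrt Real.pi : ℝ) : ℂ) * (ηrot 1)⁻¹).re := by
      rw [Complex.re_ofReal_mul]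
      have := Real.pi_pos
      positivity
    rw [integral_gaussian_complex_Ioi hre, e, one_div, Complex.sq_cpow_two_inv hpos,
      sqrt_two_div_pi]
    push_cast
    field_simp
    exact h3
  rw [hval] at hlim
  have hrem : Tendsto (fun z : ℝ => ((Real.sqrt (2 / Real.pi) : ℝ) : ℂ)
      * (ηrot z / (1 + ηrot z ^ 2)) * Complex.exp (-(ηrot z) ^ 2 / 2)) atTop (nhds 0) := by
    have hz : Tendsto (fun z : ℝ => Real.sqrt (2 / Real.pi) * ‖ηrot 1‖ * 2 * z⁻¹)
        atTop (nhds 0) := by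
      simpa using tendsto_inv_atTop_zero.const_mul (Real.sqrt (2 / Real.pi) * ‖ηrot 1‖ * 2)
    refine squeeze_zero_norm' ?_ hz
    filter_upwards [eventually_gt_atTop 0] with z hz
    have hexp : ‖Complex.exp (-(ηrot z) ^ 2 / 2)‖ ≤ 1 := by
      rw [Complex.norm_exp, ηrot_sq, Real.exp_le_one_iff, ← Complex.ofReal_pow]
      have : (-(rotSq * ((z ^ 2 : ℝ) : ℂ)) / 2).re = -(rotSq.re * z ^ 2) / 2 := by
        rw [show -(rotSq * ((z ^ 2 : ℝ) : ℂ)) / 2 = rotSq * ((-(z ^ 2) / 2 : ℝ) : ℂ) by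
          push_cast; ring, Complex.re_mul_ofReal]
        ring
      rw [this]
      nlinarith [rotSq_re, mul_nonneg (by linarith [rotSq_re] : 0 ≤ rotSq.re) (sq_nonneg z)]
    have hden : z ^ 2 / 2 ≤ ‖1 + rotSq * (z : ℂ) ^ 2‖ := by
      linarith [one_add_rotSq_mul_re z, Complex.re_le_norm (1 + rotSq * (z : ℂ) ^ 2)]
    rw [norm_mul, norm_mul, norm_div, ηrot_sq z, ηrot_eq z, norm_mul, Complex.norm_real,
      Complex.norm_real, Real.norm_of_nonneg (Real.sqrt_nonneg _), Real.norm_of_nonneg hz.le]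
    rw [ηrot_sq z] at hexp
    calc _ ≤ Real.sqrt (2 / Real.pi) * (‖ηrot 1‖ * z / (z ^ 2 / 2)) * 1 := by gcongr
      _ = _ := by field_simp
  have := hlim.add hrem
  rw [add_zero] at this
  refine this.congr fun z => ?_
  rw [profile, cerf_ηrot]
  rfl

lemma tendsto_profile_atBot : Tendsto profile atBot (nhds (-1)) := by
  have := (tendsto_profile_atTop.comp tendsto_neg_atBot_atTop).neg
  refine this.congr fun z => ?_
  simp [profile_neg]

lemma exists_norm_le_of_tendsto {W : ℝ → ℂ} {a b : ℂ} (hW : Continuous W)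
    (hBot : Tendsto W atBot (nhds a)) (hTop : Tendsto W atTop (nhds b)) :
    ∃ M, ∀ z, ‖W z‖ ≤ M := by
  obtain ⟨x, hx⟩ := eventually_atBot.1 (hBot.norm.eventually_lt_const (lt_add_one _))
  obtain ⟨y, hy⟩ := eventually_atTop.1 (hTop.norm.eventually_lt_const (lt_add_one _))
  obtain ⟨C, hC⟩ := isCompact_Icc.exists_bound_of_continuousOn (s := Set.Icc x y) hW.continuousOn
  refine ⟨max C (max (‖a‖ + 1) (‖b‖ + 1)), fun z => ?_⟩
  rcases le_total z x with h | h
  · exact (hx z h).le.trans ((le_max_left _ _).trans (le_max_right _ _))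
  rcases le_total y z with h' | h'
  · exact (hy z h').le.trans ((le_max_right _ _).trans (le_max_right _ _))
  · exact (hC z ⟨h, h'⟩).trans (le_max_left _ _)

lemma iteratedDeriv_three_mul {τ : ℂ} {W V V₁ V₂ : ℝ → ℂ}
    (hW : ∀ z, HasDerivAt W (V z) z) (hV : ∀ z, HasDerivAt V (V₁ z) z)
    (hV₁ : ∀ z, HasDerivAt V₁ (V₂ z) z) (z : ℝ) :
    iteratedDeriv 3 (fun w : ℝ => (τ - (w : ℂ) ^ 2) * W w) z
      = (τ - (z : ℂ) ^ 2) * V₂ z - 6 * z * V₁ z - 6 * V z := by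
  have dz : ∀ z : ℝ, HasDerivAt (fun z : ℝ => (z : ℂ)) 1 z :=
    fun z => (hasDerivAt_id z).ofReal_comp
  have dq : ∀ z : ℝ, HasDerivAt (fun z : ℝ => τ - (z : ℂ) ^ 2) (-2 * z) z := by
    intro z
    refine (((dz z).pow 2).const_sub τ).congr_deriv ?_
    simp
  have e1 : deriv (fun w : ℝ => (τ - (w : ℂ) ^ 2) * W w)
      = fun z : ℝ => (τ - (z : ℂ) ^ 2) * V z - 2 * z * W z := by
    ext z
    refine (((dq z).mul (hW z)).congr_deriv ?_).deriv
    ring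
  have e2 : deriv (fun z : ℝ => (τ - (z : ℂ) ^ 2) * V z - 2 * z * W z)
      = fun z : ℝ => (τ - (z : ℂ) ^ 2) * V₁ z - 4 * z * V z - 2 * W z := by
    ext z
    refine ((((dq z).mul (hV z)).sub (((dz z).const_mul 2).mul (hW z))).congr_deriv ?_).deriv
    ring
  rw [iteratedDeriv_succ, iteratedDeriv_succ, iteratedDeriv_one, e1, e2]
  refine (((((dq z).mul (hV₁ z)).sub (((dz z).const_mul 4).mul (hV z))).sub
    ((hW z).const_mul 2)).congr_deriv ?_).deriv
  ring

theorem statement2 (τ : ℂ) (hτ : τ.im < 0) (W : ℝ → ℂ) (hW : ContDiff ℝ (⊤ : ℕ∞) W)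
    (hODE : ∀ z : ℝ,
      (τ - (z : ℂ) ^ 2) ^ 2 * deriv W z
        + Complex.I * iteratedDeriv 3 (fun w : ℝ => (τ - (w : ℂ) ^ 2) * W w) z = 0)
    (hBot : Tendsto W atBot (nhds 0)) (hTop : Tendsto W atTop (nhds 1)) :
    τ = Complex.exp (Complex.I * (5 * Real.pi / 4 : ℝ)) ∧
    τ = -(1 + Complex.I) / (Real.sqrt 2 : ℝ) ∧
    ∀ z : ℝ, W z =
      (1 / 2) * (1 + cerf (ηrot z / (Real.sqrt 2 : ℝ))
        + ((Real.sqrt (2 / Real.pi) : ℝ) : ℂ) * (ηrot z / (1 + ηrot z ^ 2))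
          * Complex.exp (-(ηrot z) ^ 2 / 2)) := by
  obtain ⟨dW, hW1⟩ := contDiff_infty_iff_deriv.1 hW
  obtain ⟨dV, hW2⟩ := contDiff_infty_iff_deriv.1 hW1
  obtain ⟨dV₁, -⟩ := contDiff_infty_iff_deriv.1 hW2
  set V := deriv W with hVdef
  set V₁ := deriv V
  have hWV : ∀ z, HasDerivAt W (V z) z := fun z => (dW z).hasDerivAt
  have hV : ∀ z, HasDerivAt V (V₁ z) z := fun z => (dV z).hasDerivAt
  have hV₁ : ∀ z, HasDerivAt V₁ (deriv V₁ z) z := fun z => (dV₁ z).hasDerivAt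
  have hE : ∀ z : ℝ, (τ - (z : ℂ) ^ 2) ^ 2 * V z
      + I * ((τ - (z : ℂ) ^ 2) * deriv V₁ z - 6 * z * V₁ z - 6 * V z) = 0 := fun z => by
    rw [← iteratedDeriv_three_mul hWV hV hV₁ z]
    exact hODE z
  obtain ⟨M, hM⟩ := exists_norm_le_of_tendsto dW.continuous hBot hTop
  have key := first_order_of_bounded hτ rotSq_sq rotSq_re hWV hV hV₁ hM hE
  have hcτ : rotSq * τ + 1 = 0 := by
    by_contra hne
    have hV0 : ∀ z, V z = 0 := fun z => (mul_eq_zero.1 (key z).2).resolve_left hne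
    have hconst : W = fun _ => W 0 := funext fun z => is_const_of_deriv_eq_zero dW hV0 z 0
    rw [hconst] at hBot hTop
    have h0 := tendsto_nhds_unique hBot tendsto_const_nhds
    have h1 := tendsto_nhds_unique hTop tendsto_const_nhds
    exact zero_ne_one (h0.trans h1.symm)
  have hc0 : rotSq ≠ 0 := Complex.exp_ne_zero _
  have hq : ∀ z : ℝ, 1 + rotSq * (z : ℂ) ^ 2 = -rotSq * (τ - (z : ℂ) ^ 2) := fun z => by
    linear_combination hcτ
  have hder : ∀ z : ℝ, HasDerivAt (fun z : ℝ => V z * (1 + rotSq * (z : ℂ) ^ 2) ^ 2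
      * Complex.exp (rotSq / 2 * (z : ℂ) ^ 2)) 0 z := by
    intro z
    have dz : HasDerivAt (fun z : ℝ => (z : ℂ)) 1 z := (hasDerivAt_id z).ofReal_comp
    refine (((hV z).mul ((((dz.pow 2).const_mul rotSq).const_add 1).pow 2)).mul
      ((dz.pow 2).const_mul (rotSq / 2)).cexp).congr_deriv ?_
    simp only [Pi.mul_apply, Pi.pow_apply, hq]
    push_cast
    linear_combination (rotSq ^ 2 * (τ - (z : ℂ) ^ 2)
      * Complex.exp (rotSq / 2 * (z : ℂ) ^ 2)) * (key z).1
  have hVeq : ∀ z : ℝ, V z = V 0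
      * (Complex.exp (-(rotSq / 2) * (z : ℂ) ^ 2) / (1 + rotSq * (z : ℂ) ^ 2) ^ 2) := by
    intro z
    have h := is_const_of_deriv_eq_zero (fun z => (hder z).differentiableAt)
      (fun z => (hder z).deriv) z 0
    simp only [Complex.ofReal_zero, ne_eq, OfNat.ofNat_ne_zero, not_false_eq_true, zero_pow,
      mul_zero, add_zero, one_pow, mul_one, Complex.exp_zero] at h
    have h0 := one_add_rotSq_mul_ne_zero z
    rw [← h, neg_mul, Complex.exp_neg]
    have := Complex.exp_ne_zero (rotSq / 2 * (z : ℂ) ^ 2)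
    field_simp
  have hk : (2 * (Real.sqrt (2 / Real.pi) : ℝ) * ηrot 1 : ℂ) ≠ 0 := by
    have h1 : Real.sqrt (2 / Real.pi) ≠ 0 := (Real.sqrt_pos.2 (by positivity)).ne'
    have h2 : ηrot 1 ≠ 0 := by simp [ηrot]
    simpa [h2] using h1
  set A : ℂ := V 0 / (2 * (Real.sqrt (2 / Real.pi) : ℝ) * ηrot 1) with hA
  have hdiff : ∀ z, HasDerivAt (fun z => W z - A * profile z) 0 z := by
    intro z
    refine ((hWV z).sub ((hasDerivAt_profile z).const_mul A)).congr_deriv ?_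
    rw [hVeq z, hA, ← mul_assoc, div_mul_cancel₀ _ hk, sub_self]
  obtain ⟨B, hB⟩ : ∃ B, ∀ z, W z = B + A * profile z := by
    refine ⟨W 0 - A * profile 0, fun z => ?_⟩
    linear_combination is_const_of_deriv_eq_zero (fun z => (hdiff z).differentiableAt)
      (fun z => (hdiff z).deriv) z 0
  have hWB : W = fun z => B + A * profile z := funext hB
  have hb : 0 = B + A * -1 := tendsto_nhds_unique hBot
    (by rw [hWB]; exact (tendsto_profile_atBot.const_mul A).const_add B)
  have ht : 1 = B + A * 1 := tendsto_nhds_unique hTop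
    (by rw [hWB]; exact (tendsto_profile_atTop.const_mul A).const_add B)
  refine ⟨?_, ?_, fun z => ?_⟩
  · refine mul_left_cancel₀ hc0 ?_
    rw [eq_neg_of_add_eq_zero_left hcτ, rotSq, ← Complex.exp_add, ← Complex.exp_pi_mul_I]
    congr 1
    push_cast
    ring
  · have h3 : ((Real.sqrt 2 : ℝ) : ℂ) ^ 2 = 2 := by
      rw [← Complex.ofReal_pow, Real.sq_sqrt (by norm_num)]; norm_num
    have h2 : ((Real.sqrt 2 : ℝ) : ℂ) ≠ 0 := by simp
    refine mul_left_cancel₀ hc0 ?_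
    rw [eq_neg_of_add_eq_zero_left hcτ, rotSq_eq, div_mul_div_comm, ← sq, h3]
    linear_combination (-1 / 2) * Complex.I_sq
  · rw [hB z, add_assoc 1, ← profile]
    linear_combination (-(1 + profile z) / 2) * ht + (profile z - 1) / 2 * hb
end
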